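/- Let n ≥ 1, U = {η ∈ ℝⁿ : ηᵢ > 0 for all i and Σᵢ ηᵢ < 1}, p_{n+1}(η) = 1 − Σᵢ ηᵢ, and let G : U → Matrix (Fin n) (Fin n) ℝ be the Fisher matrix G_{ij}(η) = δ_{ij}/η_i + 1/p_{n+1}(η). Define the Levi-Civita Christoffel matrices (Γ_k)ⁱⱼ = (1/2) Σ_s (G⁻¹)ⁱˢ( ∂_k G_{sj} + ∂_j G_{sk} − ∂_s G_{kj} ) and the curvature matrices R_{kl} = ∂_kΓ_l − ∂_lΓ_k + Γ_kΓ_l − Γ_lΓ_k. Then for every η ∈ U and all vectors X, Y ∈ ℝⁿ, writing ⟪X,Y⟫_G = Xᵀ G(η) Y and R(X,Y)Z = Σ_{k,l} X_k Y_l R_{kl}(η) Z: ⟪R(X,Y)Y, X⟫_G = (1/4)( ⟪X,X⟫_G ⟪Y,Y⟫_G − ⟪X,Y⟫_G² ). That is, the Fisher information metric has constant sectional curvature 1/4. -/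

import Mathlib

open Matrix

/-- Entrywise partial derivative in the `k`-th coordinate direction of a matrix-valued map. -/
noncomputable def pd {n : ℕ} (k : Fin n) (F : (Fin n → ℝ) → Matrix (Fin n) (Fin n) ℝ)
    (x : Fin n → ℝ) : Matrix (Fin n) (Fin n) ℝ :=
  Matrix.of fun i j => fderiv ℝ (fun y => F y i j) x (Pi.single k 1)

/-- The Fisher information matrix of the open probability simplex. -/
noncomputable def fisherMatrix {n : ℕ} (y : Fin n → ℝ) : Matrix (Fin n) (Fin n) ℝ :=
  Matrix.of fun i j => (if i = j then 1 / y i else 0) + 1 / (1 - ∑ i, y i)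

theorem fisherMatrix_apply {n : ℕ} (y : Fin n → ℝ) (i j : Fin n) :
    fisherMatrix y i j = (if i = j then 1 / y i else 0) + 1 / (1 - ∑ i, y i) := rfl

/-- The open probability simplex in coordinates. -/
def openSimplex (n : ℕ) : Set (Fin n → ℝ) := {y | (∀ i, 0 < y i) ∧ ∑ i, y i < 1}

theorem isOpen_openSimplex (n : ℕ) : IsOpen (openSimplex n) := by
  have h : openSimplex n = (⋂ i, {y | 0 < y i}) ∩ {y | ∑ i, y i < 1} := by
    ext y
    simp [openSimplex]
  rw [h]
  exact (isOpen_iInter_of_finite fun i => isOpen_lt continuous_const (continuous_apply i)).inter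
    (isOpen_lt (by fun_prop) continuous_const)

/-- The third-order tensor of partial derivatives of the Fisher matrix. -/
noncomputable def fisherCubic {n : ℕ} (y : Fin n → ℝ) (k i j : Fin n) : ℝ :=
  1 / (1 - ∑ i, y i) ^ 2 - if i = j then (if i = k then 1 / y i ^ 2 else 0) else 0

theorem fisherCubic_swap_left {n : ℕ} (y : Fin n → ℝ) (k i j : Fin n) :
    fisherCubic y i k j = fisherCubic y k i j := by
  unfold fisherCubic
  split_ifs <;> simp_all

theorem fisherCubic_swap_right {n : ℕ} (y : Fin n → ℝ) (k i j : Fin n) :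
    fisherCubic y k j i = fisherCubic y k i j := by
  unfold fisherCubic
  split_ifs <;> simp_all

theorem hasFDerivAt_inv_apply {n : ℕ} {y : Fin n → ℝ} {i : Fin n} (hi : y i ≠ 0) :
    HasFDerivAt (fun z : Fin n → ℝ => 1 / z i)
      ((-(y i ^ 2)⁻¹) • ContinuousLinearMap.proj (R := ℝ) (φ := fun _ : Fin n => ℝ) i) y := by
  simpa only [one_div, Function.comp_def] using
    (hasDerivAt_inv hi).comp_hasFDerivAt y (hasFDerivAt_apply (𝕜 := ℝ) i y)

theorem hasFDerivAt_inv_one_sub_sum {n : ℕ} {y : Fin n → ℝ} (h : 1 - ∑ i, y i ≠ 0) :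
    HasFDerivAt (fun z : Fin n → ℝ => 1 / (1 - ∑ i, z i))
      ((-((1 - ∑ i, y i) ^ 2)⁻¹) •
        -∑ i, ContinuousLinearMap.proj (R := ℝ) (φ := fun _ : Fin n => ℝ) i) y := by
  have hs : HasFDerivAt (fun z : Fin n → ℝ => 1 - ∑ i, z i)
      (-∑ i, ContinuousLinearMap.proj (R := ℝ) (φ := fun _ : Fin n => ℝ) i) y :=
    (HasFDerivAt.fun_sum fun i _ => hasFDerivAt_apply (𝕜 := ℝ) i y).const_sub 1
  simpa only [one_div, Function.comp_def] using (hasDerivAt_inv h).comp_hasFDerivAt y hs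

theorem differentiableAt_fisherMatrix {n : ℕ} {y : Fin n → ℝ} (hy : y ∈ openSimplex n)
    (i j : Fin n) : DifferentiableAt ℝ (fun z => fisherMatrix z i j) y := by
  simp only [fisherMatrix_apply]
  refine DifferentiableAt.add ?_ (hasFDerivAt_inv_one_sub_sum (sub_pos.2 hy.2).ne').differentiableAt
  split_ifs
  · exact (hasFDerivAt_inv_apply (hy.1 i).ne').differentiableAt
  · exact differentiableAt_const _

theorem fderiv_fisherMatrix {n : ℕ} {y : Fin n → ℝ} (hy : y ∈ openSimplex n) (k i j : Fin n) :
    fderiv ℝ (fun z => fisherMatrix z i j) y (Pi.single k 1) = fisherCubic y k i j := by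
  have hp := hasFDerivAt_inv_one_sub_sum (sub_pos.2 hy.2).ne'
  have hi := hasFDerivAt_inv_apply (hy.1 i).ne'
  simp only [fisherMatrix_apply, fisherCubic]
  split_ifs with hij hik
  · rw [(hi.fun_add hp).fderiv]
    simp [Pi.single_apply, hik]
    ring
  · rw [(hi.fun_add hp).fderiv]
    simp [Pi.single_apply, hik]
  · rw [(hp.const_add 0).fderiv]
    simp [Pi.single_apply]

theorem fisherMatrix_inv {n : ℕ} {y : Fin n → ℝ} (hy : y ∈ openSimplex n) :
    (fisherMatrix y)⁻¹ = Matrix.of fun i j => (if i = j then y i else 0) - y i * y j := by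
  refine Matrix.inv_eq_left_inv ?_
  have hp := (sub_pos.2 hy.2).ne'
  ext i j
  have hi := (hy.1 i).ne'
  have hj := (hy.1 j).ne'
  simp only [Matrix.mul_apply, Matrix.of_apply, fisherMatrix_apply, sub_mul, mul_add,
    Finset.sum_sub_distrib, Finset.sum_add_distrib, ite_mul, mul_ite, zero_mul, mul_zero,
    Finset.sum_ite_eq, Finset.sum_ite_eq', Finset.mem_univ, if_true, Matrix.one_apply]
  rw [← Finset.sum_mul, ← Finset.mul_sum]
  split_ifs with h
  · subst h
    field_simp
    ring
  · field_simp
    ring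

/-- The Christoffel symbols of the Fisher metric in closed form. -/
noncomputable def fisherChristoffel {n : ℕ} (y : Fin n → ℝ) (k : Fin n) :
    Matrix (Fin n) (Fin n) ℝ :=
  Matrix.of fun i j =>
    (1 / 2 : ℝ) * (y i * fisherMatrix y k j - if k = j then (if i = k then 1 / y i else 0) else 0)

theorem christoffel_fisherMatrix {n : ℕ} {y : Fin n → ℝ} (hy : y ∈ openSimplex n)
    (k i j : Fin n) :
    (1 / 2 : ℝ) * ∑ s, (fisherMatrix y)⁻¹ i s *
      (fderiv ℝ (fun z => fisherMatrix z s j) y (Pi.single k 1)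
        + fderiv ℝ (fun z => fisherMatrix z s k) y (Pi.single j 1)
        - fderiv ℝ (fun z => fisherMatrix z k j) y (Pi.single s 1)) =
      fisherChristoffel y k i j := by
  have hT (s : Fin n) : fisherCubic y k s j + fisherCubic y j s k - fisherCubic y s k j =
      1 / (1 - ∑ i, y i) ^ 2 - if s = k then (if k = j then 1 / y k ^ 2 else 0) else 0 := by
    rw [fisherCubic_swap_left y k s, ← fisherCubic_swap_left y j s k,
      fisherCubic_swap_right y s k j]
    simp only [fisherCubic]
    split_ifs <;> simp_all
  have hp := (sub_pos.2 hy.2).ne'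
  have hi := (hy.1 i).ne'
  have hk := (hy.1 k).ne'
  simp only [fderiv_fisherMatrix hy, hT, fisherMatrix_inv hy]
  simp only [Matrix.of_apply, fisherChristoffel,
    fisherMatrix_apply, sub_mul, mul_sub, Finset.sum_sub_distrib, ite_mul, mul_ite, zero_mul,
    mul_zero, Finset.sum_ite_eq, Finset.sum_ite_eq', Finset.mem_univ, if_true]
  rw [← Finset.sum_mul, ← Finset.mul_sum]
  split_ifs <;> simp_all <;> field_simp <;> ring

theorem fderiv_fisherChristoffel {n : ℕ} {y : Fin n → ℝ} (hy : y ∈ openSimplex n)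
    (k l i j : Fin n) :
    fderiv ℝ (fun z => fisherChristoffel z l i j) y (Pi.single k 1) =
      (1 / 2 : ℝ) * ((if i = k then fisherMatrix y l j else 0) + y i * fisherCubic y k l j
        + if l = j then (if i = l then (if i = k then 1 / y i ^ 2 else 0) else 0) else 0) := by
  have hG := (differentiableAt_fisherMatrix hy l j).hasFDerivAt
  have hi := hasFDerivAt_apply (𝕜 := ℝ) i y
  have hinv := hasFDerivAt_inv_apply (hy.1 i).ne'
  have hT := fderiv_fisherMatrix hy k l j
  have hmul := hi.fun_mul hG
  simp only [fisherChristoffel, Matrix.of_apply]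
  by_cases h : l = j ∧ i = l
  · obtain ⟨rfl, rfl⟩ := h
    simp only [if_true]
    rw [((hmul.fun_sub hinv).const_mul (1 / 2)).fderiv]
    simp only [_root_.smul_apply, _root_.add_apply, _root_.sub_apply, hT,
      ContinuousLinearMap.proj_apply, Pi.single_apply, smul_eq_mul]
    split_ifs <;> simp <;> ring
  · have h0 (a : ℝ) : (if l = j then (if i = l then a else 0) else 0) = 0 := by
      split_ifs <;> simp_all
    simp only [h0, sub_zero, add_zero]
    rw [(hmul.const_mul (1 / 2)).fderiv]
    simp only [_root_.smul_apply, _root_.add_apply, hT,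
      ContinuousLinearMap.proj_apply, Pi.single_apply, smul_eq_mul]
    split_ifs <;> simp <;> ring

theorem fisherMatrix_mulVec_self {n : ℕ} {y : Fin n → ℝ} (hy : y ∈ openSimplex n) (k : Fin n) :
    ∑ m, fisherMatrix y k m * y m = 1 / (1 - ∑ i, y i) := by
  have hp := (sub_pos.2 hy.2).ne'
  have hk := (hy.1 k).ne'
  simp only [fisherMatrix_apply, add_mul, Finset.sum_add_distrib, ite_mul, zero_mul,
    Finset.sum_ite_eq, Finset.mem_univ, if_true]
  rw [← Finset.mul_sum]
  field_simp
  ring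

theorem fisherChristoffel_mul_apply {n : ℕ} {y : Fin n → ℝ} (hy : y ∈ openSimplex n)
    (k l i j : Fin n) :
    (fisherChristoffel y k * fisherChristoffel y l) i j =
      (1 / 4 : ℝ) * (y i * fisherMatrix y l j * (1 / (1 - ∑ i, y i))
        - y i * fisherMatrix y k l * (if l = j then 1 / y l else 0)
        - (if i = k then fisherMatrix y l j else 0)
        + if l = j then (if i = k then (if k = l then 1 / y l ^ 2 else 0) else 0) else 0) := by
  have hi := (hy.1 i).ne'
  rw [← fisherMatrix_mulVec_self hy k, Finset.mul_sum, Matrix.mul_apply]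
  have hterm (m : Fin n) : fisherChristoffel y k i m * fisherChristoffel y l m j =
      (1 / 4 : ℝ) * (y i * fisherMatrix y l j * (fisherMatrix y k m * y m)
        - (if m = l then y i * fisherMatrix y k m * (if l = j then 1 / y l else 0) else 0)
        - (if k = m then (if i = k then fisherMatrix y l j else 0) else 0)
        + if k = m then (if l = j then (if i = k then (if k = l then 1 / y l ^ 2 else 0) else 0)
            else 0) else 0) := by
    have hm := (hy.1 m).ne'
    simp only [fisherChristoffel, Matrix.of_apply]
    generalize fisherMatrix y = A
    split_ifs <;> subst_vars <;> first | contradiction | (field_simp; ring)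
  simp only [hterm, ← Finset.mul_sum, Finset.sum_add_distrib, Finset.sum_sub_distrib,
    Finset.sum_ite_eq, Finset.sum_ite_eq', Finset.mem_univ, if_true]

/-- The curvature matrices of the Fisher metric are `(1/4) (δ_{ik} G_{lj} − δ_{il} G_{kj})`. -/
theorem fisher_curvature_apply {n : ℕ} {y : Fin n → ℝ} (hy : y ∈ openSimplex n)
    (k l i j : Fin n) :
    (pd k (fun z => fisherChristoffel z l) y - pd l (fun z => fisherChristoffel z k) y
      + fisherChristoffel y k * fisherChristoffel y l
      - fisherChristoffel y l * fisherChristoffel y k) i j =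
      (1 / 4 : ℝ) * ((if i = k then fisherMatrix y l j else 0)
        - if i = l then fisherMatrix y k j else 0) := by
  have hp := (sub_pos.2 hy.2).ne'
  have hi := (hy.1 i).ne'
  simp only [Matrix.sub_apply, Matrix.add_apply, pd, Matrix.of_apply,
    fderiv_fisherChristoffel hy, fisherChristoffel_mul_apply hy]
  rw [← fisherCubic_swap_left y k l j]
  by_cases hkl : k = l
  · subst hkl
    ring
  have hlk : l ≠ k := fun h => hkl h.symm
  simp only [fisherMatrix_apply, hkl, hlk, if_false]
  split_ifs <;> subst_vars <;> first | contradiction | ring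

/-- the Fisher information metric `G_{ij}(η) = δ_{ij}/η_i + 1/p_{n+1}(η)` on
the open probability simplex has constant sectional curvature `1/4`:
`⟪R(X,Y)Y, X⟫_G = (1/4)(⟪X,X⟫_G ⟪Y,Y⟫_G − ⟪X,Y⟫_G²)`. -/
theorem stmt_14 (n : ℕ) (hn : 1 ≤ n)
    (U : Set (Fin n → ℝ)) (hU : U = {η | (∀ i, 0 < η i) ∧ ∑ i, η i < 1})
    (pn1 : (Fin n → ℝ) → ℝ) (hpn1 : ∀ η, pn1 η = 1 - ∑ i, η i)
    (G : (Fin n → ℝ) → Matrix (Fin n) (Fin n) ℝ)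
    (hG : ∀ η i j, G η i j = (if i = j then 1 / η i else 0) + 1 / pn1 η)
    (Γ : (Fin n → ℝ) → Fin n → Matrix (Fin n) (Fin n) ℝ)
    (hΓ : ∀ (η : Fin n → ℝ) (k i j : Fin n), Γ η k i j = (1 / 2 : ℝ) * ∑ s,
      (G η)⁻¹ i s * (fderiv ℝ (fun y => G y s j) η (Pi.single k 1)
        + fderiv ℝ (fun y => G y s k) η (Pi.single j 1)
        - fderiv ℝ (fun y => G y k j) η (Pi.single s 1)))
    (R : (Fin n → ℝ) → Fin n → Fin n → Matrix (Fin n) (Fin n) ℝ)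
    (hR : ∀ η k l, R η k l =
      pd k (fun y => Γ y l) η - pd l (fun y => Γ y k) η + Γ η k * Γ η l - Γ η l * Γ η k)
    (η : Fin n → ℝ) (hη : η ∈ U) (X Y : Fin n → ℝ) :
    X ⬝ᵥ (G η).mulVec (∑ k, ∑ l, (X k * Y l) • (R η k l).mulVec Y)
      = (1 / 4 : ℝ) * ((X ⬝ᵥ (G η).mulVec X) * (Y ⬝ᵥ (G η).mulVec Y)
          - (X ⬝ᵥ (G η).mulVec Y) ^ 2) := by
  subst hU
  have hGf : G = fisherMatrix := by
    funext y
    ext i j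
    rw [hG, hpn1, fisherMatrix_apply]
  subst hGf
  have hΓf {y : Fin n → ℝ} (hy : y ∈ openSimplex n) : Γ y = fisherChristoffel y := by
    funext k
    ext i j
    rw [hΓ, christoffel_fisherMatrix hy]
  have hpd (k l : Fin n) : pd k (fun y => Γ y l) η = pd k (fun y => fisherChristoffel y l) η := by
    ext i j
    simp only [pd, Matrix.of_apply]
    have he : (fun y => Γ y l i j) =ᶠ[nhds η] fun y => fisherChristoffel y l i j := by
      filter_upwards [(isOpen_openSimplex n).mem_nhds hη] with y hy
      rw [hΓf hy]
    rw [he.fderiv_eq]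
  have hRf (k l i j : Fin n) : R η k l i j = (1 / 4 : ℝ) *
      ((if i = k then fisherMatrix η l j else 0) - if i = l then fisherMatrix η k j else 0) := by
    rw [hR, hpd, hpd, hΓf hη, fisher_curvature_apply hη]
  have hsum : ∑ k, ∑ l, (X k * Y l) • (R η k l).mulVec Y = (1 / 4 : ℝ) •
      ((Y ⬝ᵥ (fisherMatrix η).mulVec Y) • X - (X ⬝ᵥ (fisherMatrix η).mulVec Y) • Y) := by
    have hmul (k l i : Fin n) : (R η k l).mulVec Y i = (1 / 4 : ℝ) *
        ((if i = k then (fisherMatrix η).mulVec Y l else 0)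
          - if i = l then (fisherMatrix η).mulVec Y k else 0) := by
      simp only [Matrix.mulVec, dotProduct, hRf]
      split_ifs <;> simp [Finset.mul_sum, mul_assoc, sub_mul, Finset.sum_sub_distrib, mul_sub]
    ext i
    simp only [Finset.sum_apply, Pi.smul_apply, Pi.sub_apply, smul_eq_mul, hmul]
    generalize (fisherMatrix η).mulVec Y = V
    simp only [mul_sub, Finset.sum_sub_distrib, mul_ite, mul_zero, dotProduct, Finset.sum_mul,
      Finset.mul_sum, Finset.sum_ite_eq, Finset.mem_univ, if_true]
    rw [Finset.sum_comm]
    simp only [Finset.sum_ite_eq, Finset.mem_univ, if_true]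
    congr 1 <;> exact Finset.sum_congr rfl fun _ _ => by ring
  have hsymm : Y ⬝ᵥ (fisherMatrix η).mulVec X = X ⬝ᵥ (fisherMatrix η).mulVec Y := by
    have ht : (fisherMatrix η)ᵀ = fisherMatrix η := by
      ext i j
      simp only [Matrix.transpose_apply, fisherMatrix_apply, eq_comm (a := j)]
      split_ifs with h
      · rw [h]
      · rfl
    rw [dotProduct_comm, ← Matrix.vecMul_transpose, ht, ← Matrix.dotProduct_mulVec]
  rw [hsum]
  simp only [Matrix.mulVec_smul, Matrix.mulVec_sub, dotProduct_smul, dotProduct_sub, smul_eq_mul]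
  ring
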